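/- arXiv:0812.1256 — 2 statements merged into one kernel-verified Lean document; each statement's English description precedes it below -/
import Mathlib

section
/- Let n and a be nonnegative integers. Then the sum over all involutions π in S_{n+a} of q^{maj(π^{>a})} equals the sum over j = 0, 1, ..., a, with k = n - a + j, of t_j · C(a,j) · [a-j]_q! · [n choose k]_q · t_k(q), where t_j is the number of involutions in S_j, C(a,j) is the ordinary binomial coefficient, [a-j]_q! is the q-factorial, [n choose k]_q is the q-binomial coefficient, and t_k(q) = Σ_{π ∈ I_k} q^{maj(π)}. -/
open Finset

namespace QT

/-- The major index of a permutation of `Fin n` (sum of descents,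
with positions written `1,...,n-1` as in one-line notation). -/
def maj {n : ℕ} (π : Equiv.Perm (Fin n)) : ℕ :=
  ∑ i ∈ Finset.range n,
    if h : i + 1 < n then
      (if π ⟨i + 1, h⟩ < π ⟨i, by omega⟩ then i + 1 else 0)
    else 0

/-- `imaj π = maj π⁻¹`. -/
def imaj {n : ℕ} (π : Equiv.Perm (Fin n)) : ℕ := maj π⁻¹

/-- The permutation of `Fin k` order-isomorphic to the word `v 0, v 1, ..., v (k-1)`. -/
noncomputable def standardize {n k : ℕ} (v : Fin k → Fin n) (hv : Function.Injective v) :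
    Equiv.Perm (Fin k) :=
  Equiv.ofBijective
    (fun i => (Finset.orderIsoOfFin (Finset.image v Finset.univ)
        (by rw [Finset.card_image_of_injective _ hv, Finset.card_univ, Fintype.card_fin])).symm
        ⟨v i, Finset.mem_image_of_mem v (Finset.mem_univ i)⟩)
    (Finite.injective_iff_bijective.mp (fun i j hij => by
      have h2 := (Finset.orderIsoOfFin _ _).symm.injective hij
      exact hv (congrArg Subtype.val h2)))

/-- `π^{≤k}` : the permutation of `Fin k` order-isomorphic to the first `k` letters of `π`. -/
noncomputable def pInit {n : ℕ} (π : Equiv.Perm (Fin n)) (k : ℕ) (hk : k ≤ n) :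
    Equiv.Perm (Fin k) :=
  standardize (fun i => π (Fin.castLE hk i))
    (fun i j h => Fin.castLE_injective hk (π.injective h))

/-- `π^{>k}` : the permutation of `Fin (n-k)` order-isomorphic to the last `n - k` letters of `π`. -/
noncomputable def pTail {n : ℕ} (π : Equiv.Perm (Fin n)) (k : ℕ) :
    Equiv.Perm (Fin (n - k)) :=
  standardize (fun i => π ⟨k + (i : ℕ), by have := i.isLt; omega⟩)
    (fun i j h => by
      have h2 : k + (i : ℕ) = k + (j : ℕ) := congrArg Fin.val (π.injective h)
      exact Fin.ext (by omega))

/-- `π_{≤k}` : the permutation of `Fin k` order-isomorphic to the subword of `π`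
consisting of the `k` smallest values.  (Equivalently `((π⁻¹)^{≤k})⁻¹`.) -/
noncomputable def vLow {n : ℕ} (π : Equiv.Perm (Fin n)) (k : ℕ) (hk : k ≤ n) :
    Equiv.Perm (Fin k) := (pInit π⁻¹ k hk)⁻¹

/-- `π_{>k}` : the permutation of `Fin (n-k)` order-isomorphic to the subword of `π`
consisting of the values `> k`.  (Equivalently `((π⁻¹)^{>k})⁻¹`.) -/
noncomputable def vHigh {n : ℕ} (π : Equiv.Perm (Fin n)) (k : ℕ) :
    Equiv.Perm (Fin (n - k)) := (pTail π⁻¹ k)⁻¹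

/-- The set `I_n` of involutions in `S_n`. -/
def involutions (n : ℕ) : Finset (Equiv.Perm (Fin n)) :=
  Finset.univ.filter fun π => π * π = 1

-- `I_n(σ) = {π ∈ I_n : π_{≤m} = σ}`.
open scoped Classical in
noncomputable def involutionsC (n : ℕ) {m : ℕ} (σ : Equiv.Perm (Fin m)) :
    Finset (Equiv.Perm (Fin n)) :=
  (involutions n).filter fun π => ∃ h : m ≤ n, vLow π m h = σ

-- `S_n(σ,τ) = {π ∈ S_n : π_{≤a} = σ, π^{≤b} = τ}`.
open scoped Classical in
noncomputable def permsC (n : ℕ) {a b : ℕ} (σ : Equiv.Perm (Fin a)) (τ : Equiv.Perm (Fin b)) :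
    Finset (Equiv.Perm (Fin n)) :=
  Finset.univ.filter fun π => ∃ (ha : a ≤ n) (hb : b ≤ n), vLow π a ha = σ ∧ pInit π b hb = τ

-- The j-set `J(σ) = {j : σ^{≤j} is an involution}`.
open scoped Classical in
noncomputable def jSet {m : ℕ} (σ : Equiv.Perm (Fin m)) : Finset ℕ :=
  (Finset.range (m + 1)).filter fun j => ∃ h : j ≤ m, pInit σ j h * pInit σ j h = 1

-- The j₂-set `J(σ,τ) = {j : σ^{≤j} = τ_{≤j}}`.
open scoped Classical in
noncomputable def j2Set {a b : ℕ} (σ : Equiv.Perm (Fin a)) (τ : Equiv.Perm (Fin b)) :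
    Finset ℕ :=
  (Finset.range (min a b + 1)).filter fun j =>
    ∃ (ha : j ≤ a) (hb : j ≤ b), pInit σ j ha = vLow τ j hb

/-- A set of nonnegative integers is a j₂-set if it is `J(σ,τ)` for some pair of
permutations. -/
def IsJ2Set (S : Finset ℕ) : Prop :=
  ∃ (a b : ℕ) (σ : Equiv.Perm (Fin a)) (τ : Equiv.Perm (Fin b)), S = j2Set σ τ

-- The number of j₂-sets with largest element `n`.
open scoped Classical in
noncomputable def j2count (n : ℕ) : ℕ :=
  ((Finset.range (n + 1)).powerset.filter
    fun S => IsJ2Set S ∧ n ∈ S ∧ ∀ x ∈ S, x ≤ n).card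

/-- `[n]_q = 1 + q + ⋯ + q^{n-1}`. -/
def qInt (q : ℝ) (n : ℕ) : ℝ := ∑ i ∈ Finset.range n, q ^ i

/-- The q-factorial `[n]_q! = ∏_{i=1}^n (1 + q + ⋯ + q^{i-1})`. -/
def qFact (q : ℝ) (n : ℕ) : ℝ := ∏ i ∈ Finset.range n, qInt q (i + 1)

/-- The Gaussian binomial coefficient `[n choose k]_q = [n]_q!/([k]_q! [n-k]_q!)`,
defined via the q-Pascal recursion. -/
def qBinom (q : ℝ) : ℕ → ℕ → ℝ
  | _, 0 => 1
  | 0, _ + 1 => 0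
  | n + 1, k + 1 => qBinom q n k + q ^ (k + 1) * qBinom q n (k + 1)

/-- `t_n(q) = Σ_{π ∈ I_n} q^{maj π}`. -/
noncomputable def tq (q : ℝ) (n : ℕ) : ℝ := ∑ π ∈ involutions n, q ^ maj π

/-- `A_n(p,q) = Σ_{π ∈ S_n} p^{imaj π} q^{maj π}`. -/
noncomputable def Apq (p q : ℝ) (n : ℕ) : ℝ :=
  ∑ π : Equiv.Perm (Fin n), p ^ imaj π * q ^ maj π

/-- The sum of `i + 1` over the descents `w i > w (i + 1)` with `i < k`: the major index of
the word `w 0, ..., w k`. -/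
def descSum (w : ℕ → ℕ) (k : ℕ) : ℕ :=
  ∑ i ∈ Finset.range k, if w (i + 1) < w i then i + 1 else 0

theorem descSum_congr {v w : ℕ → ℕ} {k : ℕ}
    (h : ∀ i < k, (v (i + 1) < v i ↔ w (i + 1) < w i)) : descSum v k = descSum w k := by
  refine Finset.sum_congr rfl fun i hi => ?_
  simp only [h i (Finset.mem_range.1 hi)]

theorem descSum_succ (w : ℕ → ℕ) (k : ℕ) :
    descSum w (k + 1) = descSum w k + if w (k + 1) < w k then k + 1 else 0 :=
  Finset.sum_range_succ _ _

/-- The word `w` with the letter `0` inserted at position `p`. -/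
def insertZero (p : ℕ) (w : ℕ → ℕ) (i : ℕ) : ℕ :=
  if i < p then w i else if i = p then 0 else w (i - 1)

theorem qInt_succ (q : ℝ) (n : ℕ) : qInt q (n + 1) = qInt q n + q ^ n :=
  Finset.sum_range_succ _ _

theorem qInt_succ' (q : ℝ) (n : ℕ) : qInt q (n + 1) = 1 + q * qInt q n := by
  simp only [qInt, Finset.sum_range_succ', Finset.mul_sum, pow_succ', pow_zero]
  ring

theorem qInt_add (q : ℝ) (m n : ℕ) : qInt q (m + n) = qInt q m + q ^ m * qInt q n := by
  simp only [qInt, Finset.sum_range_add, Finset.mul_sum, pow_add]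

theorem descSum_insertZero_last (w : ℕ → ℕ) (k : ℕ) (hw : ∀ i ≤ k, 0 < w i) :
    descSum (insertZero (k + 1) w) (k + 1) = descSum w k + (k + 1) := by
  rw [descSum_succ, descSum_congr (w := w)]
  · simp [insertZero, hw k le_rfl]
  · intro i hi
    simp [insertZero, show i < k + 1 by omega, hi]

/-- Inserting a new smallest letter in all possible ways into a word of length `k`
multiplies `q ^ maj` by `[k + 1]_q`. -/
theorem sum_descSum_insertZero (q : ℝ) (w : ℕ → ℕ) (k : ℕ) (hw : ∀ i < k, 0 < w i) :
    ∑ p ∈ Finset.range (k + 1), q ^ descSum (insertZero p w) k =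
      qInt q (k + 1) * q ^ descSum w (k - 1) := by
  induction k with
  | zero => simp [descSum, qInt]
  | succ k ih =>
    have ih' := ih fun i hi => hw i (by omega)
    rw [Finset.sum_range_succ, descSum_insertZero_last w k fun i hi => hw i (by omega)]
    rw [Finset.sum_range_succ] at ih' ⊢
    have hmid : descSum (insertZero k w) (k + 1) = descSum (insertZero k w) k := by
      rw [descSum_succ]
      simp [insertZero]
    rw [hmid]
    rcases k with _ | k
    · simp [descSum, qInt, Finset.sum_range_succ]
    have hlast := descSum_insertZero_last w k fun i hi => hw i (by omega)
    have hinit : ∀ p ∈ Finset.range (k + 1), q ^ descSum (insertZero p w) (k + 1 + 1) =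
        q ^ descSum (insertZero p w) (k + 1) * q ^ (if w (k + 1) < w k then k + 2 else 0) := by
      intro p hp
      have hp' := Finset.mem_range.1 hp
      rw [descSum_succ, pow_add]
      simp [insertZero, show ¬ k + 1 + 1 < p by omega, show ¬ k + 1 < p by omega,
        show k + 1 + 1 ≠ p by omega, show k + 1 ≠ p by omega]
    rw [Finset.sum_congr rfl hinit, ← Finset.sum_mul]
    rw [hlast] at ih' ⊢
    rw [Nat.add_sub_cancel] at ih' ⊢
    rw [descSum_succ]
    rw [← eq_sub_iff_add_eq] at ih'
    rw [ih']
    split_ifs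
    · rw [qInt_succ' q (k + 1 + 1)]
      ring
    · rw [qInt_succ q (k + 1 + 1)]
      ring

/-- The word formed by the letters of `π` after the first `a`, continued by zeros. -/
def tailWord {N : ℕ} (π : Equiv.Perm (Fin N)) (a i : ℕ) : ℕ :=
  if h : a + i < N then π ⟨a + i, h⟩ else 0

theorem standardize_lt_iff {n k : ℕ} (v : Fin k → Fin n) (hv : Function.Injective v)
    (i j : Fin k) : standardize v hv i < standardize v hv j ↔ v i < v j := by
  simp [standardize]

theorem pTail_lt_iff {N : ℕ} (π : Equiv.Perm (Fin N)) (a : ℕ) (i j : Fin (N - a)) :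
    pTail π a i < pTail π a j ↔ π ⟨a + i, by omega⟩ < π ⟨a + j, by omega⟩ :=
  standardize_lt_iff _ _ i j

theorem maj_eq_descSum {N : ℕ} (π : Equiv.Perm (Fin N)) :
    maj π = descSum (tailWord π 0) (N - 1) := by
  symm
  refine Finset.sum_subset_zero_on_sdiff (Finset.range_mono (Nat.sub_le _ _)) ?_ ?_
  · intro i hi
    rw [Finset.mem_sdiff, Finset.mem_range, Finset.mem_range] at hi
    rw [dif_neg (by omega)]
  · intro i hi
    rw [Finset.mem_range] at hi
    simp [tailWord, show i + 1 < N by omega, show i < N by omega]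

theorem maj_pTail {N : ℕ} (π : Equiv.Perm (Fin N)) (a : ℕ) :
    maj (pTail π a) = descSum (tailWord π a) (N - a - 1) := by
  rw [maj_eq_descSum]
  refine descSum_congr fun i hi => ?_
  simp only [tailWord, zero_add, show i < N - a by omega, show i + 1 < N - a by omega,
    show a + (i + 1) < N by omega, show a + i < N by omega, dif_pos]
  exact pTail_lt_iff π a _ _

theorem sum_involutions_fiber {M N : ℕ} (b : Fin (N + 1)) (ι : Fin M ↪ Fin (N + 1))
    (hι : ∀ y, y ∈ Set.range ι ↔ y ≠ 0 ∧ y ≠ b)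
    (f : Equiv.Perm (Fin (N + 1)) → ℝ) (g : Equiv.Perm (Fin M) → ℝ)
    (hfg : ∀ π σ, π b = 0 → (∀ x, π (ι x) = ι (σ x)) → f π = g σ) :
    ∑ π ∈ involutions (N + 1) with π 0 = b, f π = ∑ σ ∈ involutions M, g σ := by
  have hmem : ∀ {K : ℕ} (π : Equiv.Perm (Fin K)), π ∈ involutions K ↔ ∀ x, π (π x) = x := by
    intro K π
    simp [involutions, Equiv.ext_iff]
  have hne : ∀ x, ι x ≠ 0 ∧ ι x ≠ b := fun x => (hι _).1 ⟨x, rfl⟩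
  have h0 : (0 : Fin (N + 1)) ∉ Set.range ι := by simp [hι]
  have hb : b ∉ Set.range ι := by simp [hι]
  have hon : ∀ (σ : Equiv.Perm (Fin M)) x,
      (Equiv.swap 0 b * σ.viaEmbedding ι) (ι x) = ι (σ x) := by
    intro σ x
    rw [Equiv.Perm.mul_apply, Equiv.Perm.viaEmbedding_apply,
      Equiv.swap_apply_of_ne_of_ne (hne _).1 (hne _).2]
  have hon0 : ∀ σ : Equiv.Perm (Fin M), (Equiv.swap 0 b * σ.viaEmbedding ι) 0 = b := by
    intro σ
    rw [Equiv.Perm.mul_apply, Equiv.Perm.viaEmbedding_apply_of_notMem _ _ _ h0,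
      Equiv.swap_apply_left]
  have honb : ∀ σ : Equiv.Perm (Fin M), (Equiv.swap 0 b * σ.viaEmbedding ι) b = 0 := by
    intro σ
    rw [Equiv.Perm.mul_apply, Equiv.Perm.viaEmbedding_apply_of_notMem _ _ _ hb,
      Equiv.swap_apply_right]
  have hcases : ∀ y : Fin (N + 1), y = 0 ∨ y = b ∨ ∃ x, ι x = y := by
    intro y
    by_cases h1 : y = 0
    · exact Or.inl h1
    by_cases h2 : y = b
    · exact Or.inr (Or.inl h2)
    exact Or.inr (Or.inr ((hι y).2 ⟨h1, h2⟩))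
  symm
  refine Finset.sum_bij (fun σ _ => Equiv.swap 0 b * σ.viaEmbedding ι) ?_ ?_ ?_ ?_
  · intro σ hσ
    rw [hmem] at hσ
    rw [Finset.mem_filter, hmem]
    refine ⟨fun y => ?_, hon0 σ⟩
    rcases hcases y with rfl | rfl | ⟨x, rfl⟩
    · rw [hon0, honb]
    · rw [honb, hon0]
    · rw [hon, hon, hσ]
  · intro σ _ τ _ h
    ext1 x
    apply ι.injective
    rw [← hon σ, ← hon τ, h]
  · intro π hπ
    rw [Finset.mem_filter, hmem] at hπ
    obtain ⟨hinv, hπ0⟩ := hπ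
    have hπb : π b = 0 := by rw [← hπ0, hinv]
    have hex : ∀ x, ∃ y, ι y = π (ι x) := by
      intro x
      refine (hι _).2 ⟨fun h => (hne x).2 ?_, fun h => (hne x).1 ?_⟩
      · rw [← hinv (ι x), h, hπ0]
      · rw [← hinv (ι x), h, hπb]
    choose s hs using hex
    have hinvol : Function.Involutive s := fun x => ι.injective (by rw [hs, hs, hinv])
    refine ⟨hinvol.toPerm s, (hmem _).2 hinvol, ?_⟩
    ext1 y
    rcases hcases y with rfl | rfl | ⟨x, rfl⟩
    · rw [hon0, hπ0]
    · rw [honb, hπb]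
    · rw [hon, ← hs]
      rfl
  · intro σ _
    exact (hfg _ _ (honb σ) (hon σ)).symm

/-- The generating function over `I_N` of the major index of the `k` letters following
the first `a`. -/
def tailSum (q : ℝ) (N a k : ℕ) : ℝ :=
  ∑ π ∈ involutions N, q ^ descSum (tailWord π a) (k - 1)

theorem sum_fiber_zero (q : ℝ) (N a k : ℕ) (hk : a + k = N) :
    ∑ π ∈ involutions (N + 1) with π 0 = 0, q ^ descSum (tailWord π (a + 1)) (k - 1) =
      tailSum q N a k := by
  refine sum_involutions_fiber 0 (Fin.succEmb N) (fun y => ?_) _ _ fun π σ _ h => ?_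
  · refine ⟨?_, fun hy => Fin.exists_succ_eq.2 hy.1⟩
    rintro ⟨x, rfl⟩
    simp [Fin.succ_ne_zero]
  · have hw : ∀ i < k, tailWord π (a + 1) i = tailWord σ a i + 1 := by
      intro i hi
      have := h ⟨a + i, by omega⟩
      simp only [Fin.coe_succEmb, Fin.succ_mk] at this
      simp only [tailWord, show a + 1 + i < N + 1 by omega, show a + i < N by omega, dif_pos]
      rw [← Fin.val_succ, ← this]
      congr 3
      omega
    congr 1
    refine descSum_congr fun i hi => ?_
    rw [hw i (by omega), hw (i + 1) (by omega)]
    omega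

/-- The increasing enumeration of the complement of `{0, i + 1}`. -/
def skipTwo {M : ℕ} (i : Fin (M + 1)) : Fin M ↪o Fin (M + 2) :=
  (Fin.succAboveOrderEmb i).trans (Fin.succOrderEmb (M + 1))

theorem mem_range_skipTwo {M : ℕ} (i : Fin (M + 1)) (y : Fin (M + 2)) :
    y ∈ Set.range (skipTwo i).toEmbedding ↔ y ≠ 0 ∧ y ≠ i.succ := by
  constructor
  · rintro ⟨x, rfl⟩
    simp [skipTwo, Fin.succ_ne_zero, Fin.succAbove_ne]
  · rintro ⟨h0, hi⟩
    obtain ⟨z, rfl⟩ := Fin.exists_succ_eq.2 h0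
    obtain ⟨x, rfl⟩ := Fin.exists_succAbove_eq (x := z) (y := i) fun h => hi (by rw [h])
    exact ⟨x, by simp [skipTwo]⟩

theorem skipTwo_val {M : ℕ} (i : Fin (M + 1)) (x : Fin M) :
    (skipTwo i x : ℕ) = if (x : ℕ) < i then (x : ℕ) + 1 else (x : ℕ) + 2 := by
  simp only [skipTwo, RelEmbedding.coe_trans, Function.comp_apply, Fin.coe_succOrderEmb,
    Fin.succAboveOrderEmb_apply, Fin.val_succ, Fin.succAbove, Fin.lt_def, Fin.val_castSucc]
  split_ifs <;> simp

/-- The word `skipTwo i ∘ w`, where `w` is the tail of `σ` after the first `a` letters. -/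
def skipTail {M : ℕ} (i : Fin (M + 1)) (σ : Equiv.Perm (Fin M)) (a x : ℕ) : ℕ :=
  if h : a + x < M then skipTwo i (σ ⟨a + x, h⟩) else 0

theorem descSum_skipTail {M : ℕ} (i : Fin (M + 1)) (σ : Equiv.Perm (Fin M)) (a k : ℕ)
    (hk : a + k ≤ M) :
    descSum (skipTail i σ a) (k - 1) = descSum (tailWord σ a) (k - 1) := by
  refine descSum_congr fun x hx => ?_
  simp only [skipTail, tailWord, show a + x < M by omega, show a + (x + 1) < M by omega, dif_pos,
    ← Fin.lt_def, OrderEmbedding.lt_iff_lt]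

theorem sum_fiber_low (q : ℝ) (M a k : ℕ) (hk : a + k = M) (i : Fin (M + 1)) (hi : (i : ℕ) ≤ a) :
    ∑ π ∈ involutions (M + 2) with π 0 = i.succ,
      q ^ descSum (tailWord π (a + 2)) (k - 1) = tailSum q M a k := by
  refine sum_involutions_fiber i.succ (skipTwo i).toEmbedding (mem_range_skipTwo i) _ _
    fun π σ _ h => ?_
  rw [← descSum_skipTail i σ a k hk.le]
  have hw : ∀ x < k, tailWord π (a + 2) x = skipTail i σ a x := by
    intro x hx
    have := h ⟨a + x, by omega⟩
    simp only [tailWord, skipTail, show a + 2 + x < M + 2 by omega, show a + x < M by omega,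
      dif_pos]
    rw [RelEmbedding.coe_toEmbedding] at this
    rw [← this]
    congr 2
    ext
    rw [skipTwo_val, if_neg (by simp only; omega)]
    simp only
    omega
  congr 1
  refine descSum_congr fun x hx => ?_
  rw [hw x (by omega), hw (x + 1) (by omega)]

theorem sum_fiber_high (q : ℝ) (M a k : ℕ) (hk : a + k = M) :
    ∑ p ∈ Finset.range (k + 1), ∑ π ∈ involutions (M + 2) with (π 0 : ℕ) = a + p + 1,
      q ^ descSum (tailWord π (a + 1)) k = qInt q (k + 1) * tailSum q M a k := by
  have hp : ∀ p ∈ Finset.range (k + 1),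
      ∑ π ∈ involutions (M + 2) with (π 0 : ℕ) = a + p + 1,
        q ^ descSum (tailWord π (a + 1)) k =
      ∑ σ ∈ involutions M, q ^ descSum (insertZero p fun x => tailWord σ a x + 1) k := by
    intro p hp
    have hpk : p < k + 1 := Finset.mem_range.1 hp
    set i : Fin (M + 1) := ⟨a + p, by omega⟩ with hi
    have hfilter : {π ∈ involutions (M + 2) | (π 0 : ℕ) = a + p + 1} =
        {π ∈ involutions (M + 2) | π 0 = i.succ} := by
      simp [Fin.ext_iff, hi]
    rw [hfilter]
    refine sum_involutions_fiber i.succ (skipTwo i).toEmbedding (mem_range_skipTwo i) _ _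
      fun π σ hb h => ?_
    have hw : ∀ x ≤ k, tailWord π (a + 1) x = insertZero p (skipTail i σ a) x := by
      intro x hx
      have key : ∀ y, (hy : a + y < M) → (x = if y < p then y else y + 1) →
          tailWord π (a + 1) x = skipTail i σ a y := by
        intro y hy hxy
        have := h ⟨a + y, hy⟩
        simp only [tailWord, skipTail, show a + 1 + x < M + 2 by omega, hy, dif_pos]
        rw [RelEmbedding.coe_toEmbedding] at this
        rw [← this]
        congr 2
        ext
        rw [skipTwo_val]
        simp only [hi, Nat.add_lt_add_iff_left]
        split_ifs at hxy ⊢ <;> omega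
      rw [insertZero]
      split_ifs with h1 h2
      · exact key x (by omega) (by simp [h1])
      · subst h2
        rw [tailWord, dif_pos (by omega)]
        have : (⟨a + 1 + x, by omega⟩ : Fin (M + 2)) = i.succ := by
          ext
          simp only [hi, Fin.val_succ]
          omega
        rw [this, hb, Fin.val_zero]
      · refine key (x - 1) (by omega) ?_
        rw [if_neg (by omega)]
        omega
    congr 1
    have hlt : ∀ x y, x < k → y < k → (skipTail i σ a x < skipTail i σ a y ↔
        tailWord σ a x < tailWord σ a y) := by
      intro x y hx hy
      simp only [skipTail, tailWord, show a + x < M by omega, show a + y < M by omega, dif_pos,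
        ← Fin.lt_def, OrderEmbedding.lt_iff_lt]
    have hpos : ∀ x < k, 0 < skipTail i σ a x := by
      intro x hx
      rw [skipTail, dif_pos (by omega), skipTwo_val]
      split_ifs <;> omega
    refine descSum_congr fun x hx => ?_
    rw [hw x (by omega), hw (x + 1) (by omega)]
    simp only [insertZero]
    split_ifs <;> first
      | omega
      | (rw [hlt _ _ (by omega) (by omega)]; omega)
      | (have := hpos x (by omega); omega)
  rw [Finset.sum_congr rfl hp, Finset.sum_comm, tailSum, Finset.mul_sum]
  refine Finset.sum_congr rfl fun σ _ => ?_
  rw [sum_descSum_insertZero _ _ _ fun _ _ => Nat.succ_pos _]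
  congr 2
  exact descSum_congr fun x _ => by omega

theorem sum_involutions_split (N : ℕ) (f : Equiv.Perm (Fin (N + 1)) → ℝ) :
    ∑ π ∈ involutions (N + 1), f π =
      ∑ π ∈ involutions (N + 1) with π 0 = 0, f π +
        ∑ p ∈ Finset.range N, ∑ π ∈ involutions (N + 1) with (π 0 : ℕ) = p + 1, f π := by
  rw [← Finset.sum_fiberwise (involutions (N + 1)) (fun π => π 0) f, Fin.sum_univ_succ,
    Finset.sum_range]
  simp only [Fin.ext_iff, Fin.val_succ]

theorem tailSum_succ (q : ℝ) (a k : ℕ) :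
    tailSum q (a + k + 2) (a + 1) (k + 1) =
      tailSum q (a + k + 1) a (k + 1) + a * tailSum q (a + k) (a - 1) (k + 1) +
        qInt q (k + 1) * tailSum q (a + k) a k := by
  rw [tailSum, sum_involutions_split, sum_fiber_zero q _ a (k + 1) (by omega),
    add_assoc (tailSum _ _ _ _)]
  congr 1
  refine (Finset.sum_range_add _ a (k + 1)).trans ?_
  congr 1
  · rcases a with _ | a
    · simp
    have hlow : ∀ p ∈ Finset.range (a + 1),
        ∑ π ∈ involutions (a + 1 + k + 1 + 1) with (π 0 : ℕ) = p + 1,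
          q ^ descSum (tailWord π (a + 1 + 1)) (k + 1 - 1) =
        tailSum q (a + 1 + k) a (k + 1) := by
      intro p hp
      have hpa := Finset.mem_range.1 hp
      rw [← sum_fiber_low q (a + 1 + k) a (k + 1) (by omega) ⟨p, by omega⟩ (by simp only; omega)]
      simp only [Fin.ext_iff, Fin.val_succ]
    refine (Finset.sum_congr rfl hlow).trans ?_
    simp
  · exact sum_fiber_high q (a + k) a k rfl

theorem tailSum_zero_length (q : ℝ) (N a : ℕ) : tailSum q N a 0 = (involutions N).card := by
  simp [tailSum, descSum]

theorem card_involutions_succ_succ (b : ℕ) :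
    ((involutions (b + 2)).card : ℝ) =
      (involutions (b + 1)).card + (b + 1) * (involutions b).card := by
  have hc : ∀ N a, tailSum 1 N a 0 = (involutions N).card := tailSum_zero_length 1
  rw [← hc _ (b + 2), tailSum, sum_involutions_split,
    sum_fiber_zero 1 (b + 1) (b + 1) 0 rfl, hc]
  congr 1
  have hlow : ∀ p ∈ Finset.range (b + 1),
      ∑ π ∈ involutions (b + 1 + 1) with (π 0 : ℕ) = p + 1,
        (1 : ℝ) ^ descSum (tailWord π (b + 2)) (0 - 1) = (involutions b).card := by
    intro p hp
    have hpb := Finset.mem_range.1 hp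
    rw [← hc _ b, ← sum_fiber_low 1 b b 0 rfl ⟨p, by omega⟩ (by simp only; omega)]
    simp only [Fin.ext_iff, Fin.val_succ]
  rw [Finset.sum_congr rfl hlow]
  simp

theorem card_involutions_succ (b : ℕ) :
    ((involutions (b + 1)).card : ℝ) =
      (involutions b).card + b * (involutions (b - 1)).card := by
  rcases b with _ | b
  · have h0 : (involutions 0).card = 1 := by decide
    have h1 : (involutions 1).card = 1 := by decide
    simp [h0, h1]
  · simpa using card_involutions_succ_succ b

/-- The falling `q`-factorial `[n]_q [n-1]_q ⋯ [n-m+1]_q`. -/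
def qFalling (q : ℝ) (n m : ℕ) : ℝ := ∏ i ∈ Finset.range m, qInt q (n - i)

theorem qFalling_eq_zero (q : ℝ) {n m : ℕ} (h : n < m) : qFalling q n m = 0 :=
  Finset.prod_eq_zero (Finset.mem_range.2 h) (by simp [qInt])

theorem qFalling_succ_succ (q : ℝ) (n m : ℕ) :
    qFalling q (n + 1) (m + 1) = qInt q (n + 1) * qFalling q n m := by
  simp [qFalling, Finset.prod_range_succ', mul_comm]

theorem qBinom_eq_zero (q : ℝ) {n k : ℕ} (h : n < k) : qBinom q n k = 0 := by
  induction n generalizing k with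
  | zero =>
    obtain ⟨k, rfl⟩ := Nat.exists_eq_succ_of_ne_zero h.ne'
    simp [qBinom]
  | succ n ih =>
    obtain ⟨k, rfl⟩ := Nat.exists_eq_succ_of_ne_zero (Nat.ne_zero_of_lt h)
    simp [qBinom, ih (show n < k by omega), ih (show n < k + 1 by omega)]

theorem qBinom_self (q : ℝ) (n : ℕ) : qBinom q n n = 1 := by
  induction n with
  | zero => simp [qBinom]
  | succ n ih => simp [qBinom, ih, qBinom_eq_zero]

theorem qFact_mul_qBinom_add (q : ℝ) (m k : ℕ) :
    qFact q m * qBinom q (m + k) k = ∏ i ∈ Finset.range m, qInt q (k + i + 1) := by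
  induction k generalizing m with
  | zero =>
    have : qBinom q (m + 0) 0 = 1 := by cases m <;> simp [qBinom]
    rw [this]
    simp [qFact]
  | succ k ihk =>
    induction m with
    | zero => simp [qFact, qBinom_self]
    | succ m ihm =>
      have hV : ∏ i ∈ Finset.range (m + 1), qInt q (k + i + 1) =
          (∏ i ∈ Finset.range m, qInt q (k + 1 + i + 1)) * qInt q (k + 1) := by
        rw [Finset.prod_range_succ']
        simp only [add_zero, add_right_comm k 1, add_assoc]
      have h1 := ihk (m + 1)
      have hF : qFact q (m + 1) = qFact q m * qInt q (m + 1) := Finset.prod_range_succ _ _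
      rw [show m + 1 + (k + 1) = (m + 1 + k) + 1 by omega, qBinom, mul_add, h1, hV,
        Finset.prod_range_succ, show k + 1 + m + 1 = (k + 1) + (m + 1) by omega,
        qInt_add q (k + 1) (m + 1), ← ihm, hF, show m + 1 + k = m + (k + 1) by omega]
      ring

theorem qFact_mul_qBinom (q : ℝ) (n m : ℕ) (h : m ≤ n) :
    qFact q m * qBinom q n (n - m) = qFalling q n m := by
  obtain ⟨k, rfl⟩ := Nat.exists_eq_add_of_le h
  rw [Nat.add_sub_cancel_left, qFact_mul_qBinom_add, qFalling, ← Finset.prod_range_reflect]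
  refine Finset.prod_congr rfl fun i hi => ?_
  have := Finset.mem_range.1 hi
  congr 1
  omega

theorem tq_eq_tailSum (q : ℝ) (n : ℕ) : tq q n = tailSum q n 0 n := by
  simp only [tq, tailSum, maj_eq_descSum]

theorem sum_involutions_maj_pTail (n a : ℕ) (q : ℝ) :
    ∑ π ∈ involutions (n + a), q ^ maj (pTail π a) = tailSum q (n + a) a n := by
  simp only [maj_pTail, tailSum, Nat.add_sub_cancel]

theorem tailSum_eq_sum (q : ℝ) (n a : ℕ) :
    tailSum q (n + a) a n = ∑ m ∈ Finset.range (a + 1),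
      ((involutions (a - m)).card : ℝ) * (a.choose m : ℝ) * qFalling q n m * tq q (n - m) := by
  induction a using Nat.strong_induction_on generalizing n with
  | _ a ih =>
  rcases a with _ | a
  · have h0 : (involutions 0).card = 1 := by decide
    simp [qFalling, tq_eq_tailSum, h0]
  rcases n with _ | n
  · rw [tailSum_zero_length, zero_add, Finset.sum_range_succ', Finset.sum_eq_zero]
    · simp [qFalling, tq_eq_tailSum, tailSum_zero_length, show (involutions 0).card = 1 by decide]
    · intro m _
      rw [qFalling_eq_zero q (Nat.succ_pos m)]
      ring
  rw [show n + 1 + (a + 1) = a + n + 2 by omega, tailSum_succ]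
  have h1 := ih a (by omega) (n + 1)
  have h3 := ih a (by omega) n
  have h2 : (a : ℝ) * tailSum q (a + n) (a - 1) (n + 1) = ∑ m ∈ Finset.range (a + 1),
      ((a - m : ℕ) : ℝ) * (involutions (a - m - 1)).card * (a.choose m : ℝ) *
        qFalling q (n + 1) m * tq q (n + 1 - m) := by
    rcases a with _ | a
    · simp
    rw [show a + 1 + n = n + 1 + a by omega, Nat.add_sub_cancel, ih a (by omega) (n + 1),
      Finset.sum_range_succ _ (a + 1), Nat.sub_self, Nat.cast_zero, Finset.mul_sum]
    simp only [zero_mul, add_zero]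
    refine Finset.sum_congr rfl fun m hm => ?_
    have hm' := Finset.mem_range.1 hm
    have hc : ((a + 1 : ℕ) : ℝ) * (a.choose m : ℝ) =
        ((a + 1 - m : ℕ) : ℝ) * ((a + 1).choose m : ℝ) := by
      have := Nat.choose_mul_succ_eq a m
      rw [mul_comm, mul_comm ((a + 1 - m : ℕ) : ℝ)]
      exact_mod_cast this
    rw [show a + 1 - m - 1 = a - m by omega]
    linear_combination ((involutions (a - m)).card : ℝ) * qFalling q (n + 1) m *
      tq q (n + 1 - m) * hc
  have h4 : ∑ m ∈ Finset.range (a + 1), ((involutions (a + 1 - m)).card : ℝ) *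
      (a.choose m : ℝ) * qFalling q (n + 1) m * tq q (n + 1 - m) =
      tailSum q (a + n + 1) a (n + 1) + a * tailSum q (a + n) (a - 1) (n + 1) := by
    rw [h2, show a + n + 1 = n + 1 + a by omega, h1, ← Finset.sum_add_distrib]
    refine Finset.sum_congr rfl fun m hm => ?_
    have hm' := Finset.mem_range.1 hm
    rw [show a + 1 - m = (a - m) + 1 by omega, card_involutions_succ]
    ring
  rw [← h4, add_comm a n, h3, Finset.sum_range_succ' _ (a + 1)]
  have h5 : ∀ m ∈ Finset.range (a + 1), ((involutions (a + 1 - (m + 1))).card : ℝ) *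
      ((a + 1).choose (m + 1) : ℝ) * qFalling q (n + 1) (m + 1) * tq q (n + 1 - (m + 1)) =
      qInt q (n + 1) * (((involutions (a - m)).card : ℝ) * (a.choose m : ℝ) * qFalling q n m *
        tq q (n - m)) + ((involutions (a + 1 - (m + 1))).card : ℝ) *
        (a.choose (m + 1) : ℝ) * qFalling q (n + 1) (m + 1) * tq q (n + 1 - (m + 1)) := by
    intro m _
    rw [Nat.choose_succ_succ', qFalling_succ_succ, Nat.add_sub_add_right, Nat.add_sub_add_right]
    push_cast
    ring
  rw [Finset.sum_congr rfl h5, Finset.sum_add_distrib, ← Finset.mul_sum]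
  rw [Finset.sum_range_succ' (fun m => ((involutions (a + 1 - m)).card : ℝ) *
      (a.choose m : ℝ) * qFalling q (n + 1) m * tq q (n + 1 - m)) a,
    Finset.sum_range_succ (fun m => ((involutions (a + 1 - (m + 1))).card : ℝ) *
      (a.choose (m + 1) : ℝ) * qFalling q (n + 1) (m + 1) * tq q (n + 1 - (m + 1))) a,
    Nat.choose_succ_self]
  simp only [Nat.choose_zero_right, Nat.cast_zero]
  ring

/-- For nonnegative integers `n, a`,
`Σ_{π ∈ I_{n+a}} q^{maj(π^{>a})} = Σ_{j=0}^{a} t_j C(a,j) [a-j]_q! [n choose k]_q t_k(q)`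
where `k = n - a + j` (terms with `k < 0` vanish). -/
theorem stmt0 (n a : ℕ) (q : ℝ) :
    ∑ π ∈ involutions (n + a), q ^ maj (pTail π a) =
      ∑ j ∈ Finset.range (a + 1),
        if a ≤ n + j then
          ((involutions j).card : ℝ) * (a.choose j : ℝ) * qFact q (a - j) *
            qBinom q n (n + j - a) * tq q (n + j - a)
        else 0 := by
  rw [sum_involutions_maj_pTail, tailSum_eq_sum]
  rw [← Finset.sum_range_reflect]
  refine Finset.sum_congr rfl fun j hj => ?_
  have hja : j ≤ a := by simpa [Nat.lt_succ_iff] using hj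
  rw [show a + 1 - 1 - j = a - j by omega, Nat.sub_sub_self hja, Nat.choose_symm hja]
  split_ifs with h
  · rw [show n + j - a = n - (a - j) by omega,
      ← qFact_mul_qBinom q n (a - j) (by omega)]
    ring
  · rw [qFalling_eq_zero q (by omega)]
    ring

end QT
end

section
/- Let a, b, n, m, ℓ be nonnegative integers with a + m = b + n = ℓ, and let σ ∈ S_a, τ ∈ S_b. Then |S_ℓ(σ,τ)| = Σ_{j ∈ J(σ,τ), k = n - a + j} C(m,k) · C(n,k) · k!, where C(m,k) is the ordinary binomial coefficient. -/
open Finset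

namespace QT

theorem perm_eq_of_lt_iff {k : ℕ} {ρ ρ' : Equiv.Perm (Fin k)}
    (h : ∀ i j, ρ i < ρ j ↔ ρ' i < ρ' j) : ρ = ρ' := by
  have hm : StrictMono (fun i => ρ' (ρ⁻¹ i)) := fun _ _ hij => by
    rw [← h]; simpa using hij
  have key : ∀ i, ρ' (ρ⁻¹ i) = i := fun i => by
    have := Subsingleton.elim
      (hm.orderIsoOfSurjective _ (ρ'.surjective.comp (ρ⁻¹).surjective)) (OrderIso.refl _)
    exact DFunLike.congr_fun this i
  ext i
  simpa using congrArg Fin.val (key (ρ i)).symm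

theorem pInit_lt_iff {n k : ℕ} (π : Equiv.Perm (Fin n)) (hk : k ≤ n) (i j : Fin k) :
    pInit π k hk i < pInit π k hk j ↔ π (Fin.castLE hk i) < π (Fin.castLE hk j) :=
  standardize_lt_iff _ _ _ _

theorem pInit_eq_iff {n k : ℕ} {π : Equiv.Perm (Fin n)} {hk : k ≤ n} {ρ : Equiv.Perm (Fin k)} :
    pInit π k hk = ρ ↔ ∀ i j, π (Fin.castLE hk i) < π (Fin.castLE hk j) ↔ ρ i < ρ j := by
  refine ⟨fun h i j => by rw [← h, pInit_lt_iff], fun h => perm_eq_of_lt_iff fun i j => ?_⟩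
  rw [pInit_lt_iff, h]

theorem vLow_eq_iff {n k : ℕ} {π : Equiv.Perm (Fin n)} {hk : k ≤ n} {ρ : Equiv.Perm (Fin k)} :
    vLow π k hk = ρ ↔
      ∀ x y, π⁻¹ (Fin.castLE hk x) < π⁻¹ (Fin.castLE hk y) ↔ ρ⁻¹ x < ρ⁻¹ y := by
  rw [vLow, inv_eq_iff_eq_inv, pInit_eq_iff]

theorem vLow_inv_lt_iff {n k : ℕ} (π : Equiv.Perm (Fin n)) (hk : k ≤ n) (x y : Fin k) :
    (vLow π k hk)⁻¹ x < (vLow π k hk)⁻¹ y ↔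
      π⁻¹ (Fin.castLE hk x) < π⁻¹ (Fin.castLE hk y) :=
  (vLow_eq_iff.1 rfl x y).symm

theorem pInit_self {n : ℕ} (π : Equiv.Perm (Fin n)) : pInit π n le_rfl = π :=
  pInit_eq_iff.2 fun _ _ => Iff.rfl

theorem pInit_pInit {n k l : ℕ} (π : Equiv.Perm (Fin n)) (hl : l ≤ n) (hk : k ≤ l) :
    pInit (pInit π l hl) k hk = pInit π k (hk.trans hl) :=
  pInit_eq_iff.2 fun i j => by
    rw [pInit_lt_iff, pInit_lt_iff]; rfl

/-- The permutation obtained from `τ` by appending the last letter `v`, raising by one the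
letters of `τ` that are at least `v`. -/
def appendLast {b : ℕ} (τ : Equiv.Perm (Fin b)) (v : Fin (b + 1)) : Equiv.Perm (Fin (b + 1)) :=
  finSuccEquivLast.trans ((Equiv.optionCongr τ).trans (finSuccEquiv' v).symm)

@[simp] theorem appendLast_last {b : ℕ} (τ : Equiv.Perm (Fin b)) (v : Fin (b + 1)) :
    appendLast τ v (Fin.last b) = v := by
  simp [appendLast]

@[simp] theorem appendLast_castSucc {b : ℕ} (τ : Equiv.Perm (Fin b)) (v : Fin (b + 1))
    (i : Fin b) : appendLast τ v i.castSucc = v.succAbove (τ i) := by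
  simp [appendLast]

@[simp] theorem appendLast_inv_self {b : ℕ} (τ : Equiv.Perm (Fin b)) (v : Fin (b + 1)) :
    (appendLast τ v)⁻¹ v = Fin.last b := by
  rw [Equiv.Perm.inv_eq_iff_eq, appendLast_last]

@[simp] theorem appendLast_inv_succAbove {b : ℕ} (τ : Equiv.Perm (Fin b)) (v : Fin (b + 1))
    (x : Fin b) : (appendLast τ v)⁻¹ (v.succAbove x) = (τ⁻¹ x).castSucc := by
  rw [Equiv.Perm.inv_eq_iff_eq, appendLast_castSucc]
  simp

theorem pInit_appendLast {b : ℕ} (τ : Equiv.Perm (Fin b)) (v : Fin (b + 1)) :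
    pInit (appendLast τ v) b b.le_succ = τ :=
  pInit_eq_iff.2 fun i j => by
    change appendLast τ v i.castSucc < appendLast τ v j.castSucc ↔ _
    simp [(Fin.strictMono_succAbove v).lt_iff_lt]

theorem appendLast_pInit {b : ℕ} (τ : Equiv.Perm (Fin (b + 1))) :
    appendLast (pInit τ b b.le_succ) (τ (Fin.last b)) = τ := by
  let f : Equiv.Perm (Fin b) × Fin (b + 1) → Equiv.Perm (Fin (b + 1)) :=
    fun p => appendLast p.1 p.2
  have hf : f.Injective := fun p q h => by
    refine Prod.ext ?_ ?_
    · rw [← pInit_appendLast p.1 p.2, ← pInit_appendLast q.1 q.2]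
      exact congrArg (fun ρ => pInit ρ b b.le_succ) h
    · simpa [f] using DFunLike.congr_fun h (Fin.last b)
  have hb : f.Bijective := (Fintype.bijective_iff_injective_and_card f).2 ⟨hf, by
    simp [Fintype.card_perm, Nat.factorial_succ, mul_comm]⟩
  obtain ⟨⟨τ', v⟩, rfl⟩ := hb.2 τ
  simp only [f, pInit_appendLast, appendLast_last]

theorem eq_appendLast_iff {b : ℕ} {ρ : Equiv.Perm (Fin (b + 1))} {τ : Equiv.Perm (Fin b)}
    {v : Fin (b + 1)} :
    ρ = appendLast τ v ↔ pInit ρ b b.le_succ = τ ∧ ρ (Fin.last b) = v := by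
  constructor
  · rintro rfl
    exact ⟨pInit_appendLast _ _, appendLast_last _ _⟩
  · rintro ⟨rfl, rfl⟩
    exact (appendLast_pInit ρ).symm

theorem vLow_appendLast_of_le {b j : ℕ} (τ : Equiv.Perm (Fin b)) (v : Fin (b + 1))
    (hj : j ≤ v) (hb : j ≤ b) :
    vLow (appendLast τ v) j (hb.trans b.le_succ) = vLow τ j hb := by
  have h : ∀ x : Fin j, Fin.castLE (hb.trans b.le_succ) x = v.succAbove (Fin.castLE hb x) := by
    intro x
    rw [Fin.succAbove_of_castSucc_lt _ _ (by rw [Fin.lt_def]; simp; omega)]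
    rfl
  refine vLow_eq_iff.2 fun x y => ?_
  rw [vLow_inv_lt_iff, h, h, appendLast_inv_succAbove, appendLast_inv_succAbove,
    Fin.castSucc_lt_castSucc_iff]

theorem vLow_appendLast_castLE {b i : ℕ} (τ : Equiv.Perm (Fin b)) (hb : i ≤ b)
    (v : Fin (i + 1)) :
    vLow (appendLast τ (Fin.castLE (Nat.succ_le_succ hb) v)) (i + 1) (Nat.succ_le_succ hb) =
      appendLast (vLow τ i hb) v := by
  have h : ∀ x : Fin i, Fin.castLE (Nat.succ_le_succ hb) (v.succAbove x) =
      (Fin.castLE (Nat.succ_le_succ hb) v).succAbove (Fin.castLE hb x) := by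
    intro x
    ext
    simp [Fin.succAbove, Fin.lt_def]
    split_ifs <;> simp
  refine vLow_eq_iff.2 fun x y => ?_
  cases x using Fin.succAboveCases v <;> cases y using Fin.succAboveCases v <;>
    simp only [h, appendLast_inv_self, appendLast_inv_succAbove, Fin.castSucc_lt_last,
      Fin.castSucc_lt_castSucc_iff, (Fin.castSucc_lt_last _).not_gt, lt_self_iff_false,
      vLow_inv_lt_iff]

theorem mem_j2Set {a b : ℕ} {σ : Equiv.Perm (Fin a)} {τ : Equiv.Perm (Fin b)} {j : ℕ} :
    j ∈ j2Set σ τ ↔ ∃ (ha : j ≤ a) (hb : j ≤ b), pInit σ j ha = vLow τ j hb := by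
  rw [j2Set, mem_filter, mem_range, and_iff_right_iff_imp]
  rintro ⟨ha, hb, -⟩
  omega

theorem mem_j2Set_appendLast_of_le {a b j : ℕ} {σ : Equiv.Perm (Fin a)}
    {τ : Equiv.Perm (Fin b)} {v : Fin (b + 1)} (hj : j ≤ v) :
    j ∈ j2Set σ (appendLast τ v) ↔ j ∈ j2Set σ τ := by
  have hb : j ≤ b := by omega
  simp only [mem_j2Set, hb, hb.trans b.le_succ, exists_true_left, vLow_appendLast_of_le τ v hj hb]

theorem succ_mem_j2Set_appendLast {a b i : ℕ} {σ : Equiv.Perm (Fin a)}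
    {τ : Equiv.Perm (Fin b)} {v : Fin (b + 1)} :
    (i + 1 ∈ j2Set σ (appendLast τ v) ∧ (v : ℕ) < i + 1) ↔
      i ∈ j2Set σ τ ∧ ∃ ha : i + 1 ≤ a, (pInit σ (i + 1) ha (Fin.last i) : ℕ) = v := by
  simp only [mem_j2Set]
  constructor
  · rintro ⟨⟨ha, hb, h⟩, hv⟩
    have hb' : i ≤ b := by omega
    obtain ⟨w, rfl⟩ : ∃ w : Fin (i + 1), Fin.castLE (Nat.succ_le_succ hb') w = v :=
      ⟨⟨v, hv⟩, rfl⟩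
    rw [vLow_appendLast_castLE τ hb', eq_appendLast_iff, pInit_pInit] at h
    exact ⟨⟨_, hb', h.1⟩, ha, by rw [h.2]; rfl⟩
  · rintro ⟨⟨ha', hb, h⟩, ha, hv⟩
    obtain ⟨w, rfl⟩ : ∃ w : Fin (i + 1), Fin.castLE (Nat.succ_le_succ hb) w = v :=
      ⟨pInit σ (i + 1) ha (Fin.last i), Fin.ext hv⟩
    refine ⟨⟨ha, Nat.succ_le_succ hb, ?_⟩, w.2⟩
    rw [vLow_appendLast_castLE τ hb, eq_appendLast_iff, pInit_pInit]
    exact ⟨h, Fin.ext hv⟩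

open scoped Classical in
theorem sum_j2Set_appendLast {a b : ℕ} (σ : Equiv.Perm (Fin a)) (τ : Equiv.Perm (Fin b))
    (v : Fin (b + 1)) (g : ℕ → ℕ) :
    ∑ j ∈ j2Set σ (appendLast τ v), g j =
      ∑ j ∈ j2Set σ τ, ((if j ≤ (v : ℕ) then g j else 0) +
        if ∃ ha : j + 1 ≤ a, (pInit σ (j + 1) ha (Fin.last j) : ℕ) = v then g (j + 1) else 0) := by
  rw [sum_add_distrib, ← sum_filter, ← sum_filter,
    ← sum_filter_add_sum_filter_not (j2Set σ (appendLast τ v)) (· ≤ (v : ℕ))]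
  congr 1
  · refine sum_congr (ext fun j => ?_) fun _ _ => rfl
    simp only [mem_filter]
    exact and_congr_left mem_j2Set_appendLast_of_le
  · rw [← sum_image (f := g) (g := Nat.succ) (Nat.succ_injective.injOn)]
    refine sum_congr (ext fun j => ?_) fun _ _ => rfl
    cases j with
    | zero => simp
    | succ i =>
      simp only [mem_filter, mem_image, Nat.succ_eq_add_one, Nat.add_right_cancel_iff,
        exists_eq_right, not_le]
      exact succ_mem_j2Set_appendLast

theorem sum_sum_j2Set_appendLast {a b : ℕ} (σ : Equiv.Perm (Fin a)) (τ : Equiv.Perm (Fin b))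
    (g : ℕ → ℕ) (hg : g (a + 1) = 0) :
    ∑ v, ∑ j ∈ j2Set σ (appendLast τ v), g j =
      ∑ j ∈ j2Set σ τ, ((b + 1 - j) * g j + g (j + 1)) := by
  classical
  simp_rw [sum_j2Set_appendLast]
  rw [sum_comm]
  refine sum_congr rfl fun j hj => ?_
  obtain ⟨ha, hb, -⟩ := mem_j2Set.1 hj
  rw [sum_add_distrib]
  congr 1
  · rw [Fin.sum_univ_eq_sum_range (fun v => if j ≤ v then g j else 0), ← sum_filter, sum_const,
      smul_eq_mul]
    congr 1
    rw [← Nat.card_Ico]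
    congr 1
    ext v
    simp [and_comm]
  · rcases ha.lt_or_eq with ha | rfl
    · rw [sum_eq_single ⟨pInit σ (j + 1) ha (Fin.last j), by omega⟩]
      · simp [Nat.succ_le_of_lt ha]
      · rintro v - hv
        rw [if_neg]
        rintro ⟨_, h⟩
        exact hv (Fin.ext h.symm)
      · simp
    · simp [hg]

theorem mem_permsC {n a b : ℕ} {σ : Equiv.Perm (Fin a)} {τ : Equiv.Perm (Fin b)}
    {π : Equiv.Perm (Fin n)} :
    π ∈ permsC n σ τ ↔ ∃ (ha : a ≤ n) (hb : b ≤ n), vLow π a ha = σ ∧ pInit π b hb = τ := by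
  simp [permsC]

theorem card_permsC_eq_sum_appendLast {a b ℓ : ℕ} (hb : b + 1 ≤ ℓ) (σ : Equiv.Perm (Fin a))
    (τ : Equiv.Perm (Fin b)) :
    (permsC ℓ σ τ).card = ∑ v, (permsC ℓ σ (appendLast τ v)).card := by
  classical
  rw [card_eq_sum_card_fiberwise (f := fun π => pInit π (b + 1) hb (Fin.last b))
    (t := univ) (by simp)]
  refine sum_congr rfl fun v _ => congrArg card (ext fun π => ?_)
  simp only [mem_filter, mem_permsC, hb, (Nat.le_succ b).trans hb, exists_true_left,
    eq_appendLast_iff, pInit_pInit, exists_and_right, and_assoc]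

theorem card_permsC_self {a ℓ : ℕ} (ha : a ≤ ℓ) (σ : Equiv.Perm (Fin a))
    (τ : Equiv.Perm (Fin ℓ)) :
    (permsC ℓ σ τ).card = if a ∈ j2Set σ τ then 1 else 0 := by
  have h : ∀ π, π ∈ permsC ℓ σ τ ↔ π = τ ∧ a ∈ j2Set σ τ := fun π => by
    simp only [mem_permsC, mem_j2Set, pInit_self, ha, le_refl, exists_true_left]
    constructor
    · rintro ⟨h, rfl⟩
      exact ⟨rfl, h.symm⟩
    · rintro ⟨rfl, h⟩
      exact ⟨h.symm, rfl⟩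
  split_ifs with hj
  · exact card_eq_one.2 ⟨τ, ext fun π => by simp [h, hj]⟩
  · exact card_eq_zero.2 (eq_empty_of_forall_notMem fun π => by simp [h, hj])

/-- The number of permutations in `S_ℓ(σ,τ)` having exactly `j` of the first `ℓ - n` letters
among the `a` smallest values, where `ℓ = a + m` and `j ∈ J(σ,τ)`. -/
def weight (a m n j : ℕ) : ℕ :=
  if a ≤ n + j then
    m.choose (n + j - a) * n.choose (n + j - a) * (n + j - a).factorial
  else 0

theorem weight_succ {a b m n j : ℕ} (h : b + (n + 1) = a + m) (hj : j ≤ b) :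
    weight a m (n + 1) j = (b + 1 - j) * weight a m n j + weight a m n (j + 1) := by
  unfold weight
  rcases lt_trichotomy a (n + 1 + j) with ha | ha | ha
  · obtain ⟨k, hk⟩ := Nat.exists_eq_add_of_le (Nat.le_of_lt_succ (show a < n + j + 1 by omega))
    rw [if_pos (by omega), if_pos (by omega), if_pos (by omega),
      show n + 1 + j - a = k + 1 by omega, show n + j - a = k by omega,
      show n + (j + 1) - a = k + 1 by omega, show b + 1 - j = m - k by omega]
    have hc := Nat.choose_succ_right_eq m k
    rw [Nat.choose_succ_succ n k, Nat.factorial_succ]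
    linear_combination (n.choose k * k.factorial) * hc
  · subst ha
    rw [if_pos (by omega), if_neg (by omega), if_pos (by omega),
      show n + (j + 1) - (n + 1 + j) = 0 by omega]
    simp
  · rw [if_neg (by omega), if_neg (by omega), if_neg (by omega)]
    simp

theorem card_permsC {a m : ℕ} (σ : Equiv.Perm (Fin a)) (n : ℕ) :
    ∀ {b : ℕ} (_ : b + n = a + m) (τ : Equiv.Perm (Fin b)),
      (permsC (a + m) σ τ).card = ∑ j ∈ j2Set σ τ, weight a m n j := by
  induction n with
  | zero =>
    rintro _ rfl τ
    rw [card_permsC_self (Nat.le_add_right a m), ← sum_ite_eq' (j2Set σ τ) a fun _ => 1]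
    refine sum_congr rfl fun j hj => ?_
    obtain ⟨ha, -⟩ := mem_j2Set.1 hj
    rcases ha.lt_or_eq with ha | rfl
    · simp [weight, ha.ne, ha]
    · simp [weight]
  | succ n ih =>
    intro b h τ
    rw [card_permsC_eq_sum_appendLast (by omega)]
    simp_rw [ih (show b + 1 + n = a + m by omega)]
    rw [sum_sum_j2Set_appendLast σ τ _ (by
      simp [weight, show n + (a + 1) - a = n + 1 by omega])]
    refine sum_congr rfl fun j hj => ?_
    obtain ⟨-, hb, -⟩ := mem_j2Set.1 hj
    exact (weight_succ h hb).symm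

/-- For `a + m = b + n = ℓ`, `σ ∈ S_a`, `τ ∈ S_b`,
`|S_ℓ(σ,τ)| = Σ_{j ∈ J(σ,τ)} C(m,k) C(n,k) k!` with `k = n - a + j`
(terms with `k < 0` vanish). -/
theorem stmt4 (a b n m ℓ : ℕ) (h1 : a + m = ℓ) (h2 : b + n = ℓ)
    (σ : Equiv.Perm (Fin a)) (τ : Equiv.Perm (Fin b)) :
    (permsC ℓ σ τ).card =
      ∑ j ∈ j2Set σ τ,
        if a ≤ n + j then
          m.choose (n + j - a) * n.choose (n + j - a) * (n + j - a).factorial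
        else 0 := by
  subst h1
  exact card_permsC σ n h2 τ

end QT
end
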